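/- arXiv:2605.13074 — 3 statements merged into one kernel-verified Lean document; each statement's English description precedes it below -/
import Mathlib

section
/- Let G be a directed graph and (u, v) an ordered pair of distinct nodes. Then (u, v) is a weak superbubble by Gärtner et al.'s definition if and only if it is a weak superbubble by the less redundant definition; moreover, if (u, v) is a weak superbubble with component U by Gärtner et al.'s definition and component U′ by the less redundant definition, then U = U′. -/
namespace BidirectedDoubling

/-- A signed node: a node together with a sign (`true` = `+`, `false` = `-`). -/
abbrev SNode (V : Type*) := V × Bool

/-- The opposite signed node `vα̂` of `vα`. -/
def opp {V : Type*} (x : SNode V) : SNode V := (x.1, !x.2)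

/-- A bidirected graph on node type `V`, given by its set of bidirected edges,
which are unordered pairs of signed nodes. -/
abbrev BEdges (V : Type*) := Set (Sym2 (SNode V))

/-- One step of a bidirected walk within the edge set `F`: a walk leaving `a` with
sign `a.2` and then leaving `b` with sign `b.2` uses the edge `{a, opp b}`. -/
def BStep {V : Type*} (F : BEdges V) (a b : SNode V) : Prop := s(a, opp b) ∈ F

/-- A bidirected walk within the edge set `F`: a sequence `v₁α₁, …, v_ℓα_ℓ` of signed
nodes with `{vᵢαᵢ, v_{i+1}α̂ᵢ₊₁} ∈ F` for all `1 ≤ i < ℓ`. -/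
def IsBWalk {V : Type*} (F : BEdges V) (w : List (SNode V)) : Prop :=
  List.Chain' (BStep F) w

/-- A bidirected path: a walk containing each node at most once
(for each node `w` at most one of `w+` and `w−` occurs, and at most once). -/
def IsBPath {V : Type*} (F : BEdges V) (w : List (SNode V)) : Prop :=
  IsBWalk F w ∧ (w.map Prod.fst).Nodup

/-- A bidirected `a`-`b`-path. -/
def IsBPathFrom {V : Type*} (F : BEdges V) (a b : SNode V) (w : List (SNode V)) : Prop :=
  IsBPath F w ∧ w.head? = some a ∧ w.getLast? = some b

/-- The list of edges used by a bidirected walk. -/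
def bWalkEdges {V : Type*} (w : List (SNode V)) : List (Sym2 (SNode V)) :=
  List.zipWith (fun a b => s(a, opp b)) w w.tail

/-- The edge set `F` contains a proper cycloid: a `vγ`-`vδ`-walk with at least one edge,
where the signs `γ` and `δ` may or may not be equal. -/
def HasProperCycloid {V : Type*} (F : BEdges V) : Prop :=
  ∃ w : List (SNode V), IsBWalk F w ∧ 2 ≤ w.length ∧
    ∃ a b : SNode V, w.head? = some a ∧ w.getLast? = some b ∧ a.1 = b.1

/-- Node set of the ultrabubble component of `{uα, vβ}` (simplified definition):
`u`, `v` and all nodes on `uα`-`vβ̂`-paths. -/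
def ubNodes {V : Type*} (E : BEdges V) (u : V) (α : Bool) (v : V) (β : Bool) : Set V :=
  {u, v} ∪ {x | ∃ w, IsBPathFrom E (u, α) (v, !β) w ∧ x ∈ w.map Prod.fst}

/-- Edge set of the ultrabubble component of `{uα, vβ}` (simplified definition):
all edges on `uα`-`vβ̂`-paths. -/
def ubEdges {V : Type*} (E : BEdges V) (u : V) (α : Bool) (v : V) (β : Bool) : BEdges V :=
  {e | ∃ w, IsBPathFrom E (u, α) (v, !β) w ∧ e ∈ bWalkEdges w}

/-- Separability of `{uα, vβ}` in the simplified ultrabubble definition: every signed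
node `wγ` contained in an edge of `E` outside the ultrabubble component `B` satisfies
`w ∉ V(B)`, or `wγ = uα̂`, or `wγ = vβ̂`. -/
def UBSeparable {V : Type*} (E : BEdges V) (u : V) (α : Bool) (v : V) (β : Bool) : Prop :=
  ∀ e ∈ E, e ∉ ubEdges E u α v β →
    ∀ x : SNode V, x ∈ e →
      x.1 ∉ ubNodes E u α v β ∨ x = (u, !α) ∨ x = (v, !β)

/-- Acyclicity of `{uα, vβ}` in the simplified ultrabubble definition:
the ultrabubble component contains no proper cycloid. -/
def UBAcyclic {V : Type*} (E : BEdges V) (u : V) (α : Bool) (v : V) (β : Bool) : Prop :=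
  ¬ HasProperCycloid (ubEdges E u α v β)

/-- `{uα, vβ}` is an ultrabubble by the simplified definition. -/
def IsUltrabubbleSimp {V : Type*} (E : BEdges V) (u : V) (α : Bool) (v : V) (β : Bool) :
    Prop :=
  u ≠ v ∧ UBSeparable E u α v β ∧ UBAcyclic E u α v β ∧
  ¬ ∃ (w : V) (γ : Bool), w ∈ ubNodes E u α v β ∧ w ≠ u ∧ w ≠ v ∧
    (UBSeparable E u α w γ ∧ UBAcyclic E u α w γ) ∧
    (UBSeparable E w (!γ) v β ∧ UBAcyclic E w (!γ) v β)

section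
open Classical

/-- Image of a signed node under splitting the signed nodes `uα` and `vβ`:
the signed node `uα̂` is replaced by `u′α̂` and `vβ̂` by `v′β̂`, where
`Sum.inr false` plays the role of the new node `u′` and `Sum.inr true` of `v′`. -/
noncomputable def splitSN {V : Type*} (u : V) (α : Bool) (v : V) (β : Bool)
    (x : SNode V) : SNode (V ⊕ Bool) :=
  if x = (u, !α) then (Sum.inr false, !α)
  else if x = (v, !β) then (Sum.inr true, !β)
  else (Sum.inl x.1, x.2)

end

/-- The edge set of the graph obtained from `E` by splitting `uα` and `vβ`. -/
noncomputable def splitEdges {V : Type*} (E : BEdges V) (u : V) (α : Bool) (v : V)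
    (β : Bool) : BEdges (V ⊕ Bool) :=
  (Sym2.map (splitSN u α v β)) '' E

/-- Undirected adjacency (ignoring signs) within an edge set. -/
def bAdj {W : Type*} (F : BEdges W) (x y : W) : Prop :=
  ∃ γ δ : Bool, s((x, γ), (y, δ)) ∈ F

/-- Connectivity in the graph obtained by splitting `uα` and `vβ`. -/
def splitReach {V : Type*} (E : BEdges V) (u : V) (α : Bool) (v : V) (β : Bool)
    (x y : V ⊕ Bool) : Prop :=
  Relation.ReflTransGen (bAdj (splitEdges E u α v β)) x y

/-- `{uα, vβ}` is separable (original definition): the graph obtained by splitting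
`uα` and `vβ` has a connected component containing `u` and `v` but neither `u′` nor `v′`. -/
def SeparableOrig {V : Type*} (E : BEdges V) (u : V) (α : Bool) (v : V) (β : Bool) : Prop :=
  splitReach E u α v β (Sum.inl u) (Sum.inl v) ∧
  ¬ splitReach E u α v β (Sum.inl u) (Sum.inr false) ∧
  ¬ splitReach E u α v β (Sum.inl u) (Sum.inr true)

/-- Node set of the ultrabubble component of `{uα, vβ}` by the original definition:
the connected component of `u` in the split graph (as nodes of `G`). -/
def origNodes {V : Type*} (E : BEdges V) (u : V) (α : Bool) (v : V) (β : Bool) : Set V :=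
  {x | splitReach E u α v β (Sum.inl u) (Sum.inl x)}

/-- Edge set of the ultrabubble component of `{uα, vβ}` by the original definition:
the edges of `E` lying (after splitting) in the connected component of `u`. -/
def origEdges {V : Type*} (E : BEdges V) (u : V) (α : Bool) (v : V) (β : Bool) : BEdges V :=
  {e | e ∈ E ∧ ∀ x : SNode (V ⊕ Bool), x ∈ Sym2.map (splitSN u α v β) e →
    splitReach E u α v β (Sum.inl u) x.1}

/-- A tip with respect to the edge set `F`: a node all of whose incident edges
meet it with the same sign. -/
def IsTip {V : Type*} (F : BEdges V) (x : V) : Prop :=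
  (∀ e ∈ F, ((x, true) : SNode V) ∉ e) ∨ (∀ e ∈ F, ((x, false) : SNode V) ∉ e)

/-- `{uα, vβ}` is an ultrabubble by the original definition: separable, tipless,
acyclic and minimal. -/
def IsUltrabubbleOrig {V : Type*} (E : BEdges V) (u : V) (α : Bool) (v : V) (β : Bool) :
    Prop :=
  u ≠ v ∧ SeparableOrig E u α v β ∧
  (∀ x ∈ origNodes E u α v β, x ≠ u → x ≠ v → ¬ IsTip (origEdges E u α v β) x) ∧
  ¬ HasProperCycloid (origEdges E u α v β) ∧
  ¬ ∃ (w : V) (γ : Bool), w ∈ origNodes E u α v β ∧ w ≠ u ∧ w ≠ v ∧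
    SeparableOrig E u α w γ ∧ SeparableOrig E w (!γ) v β

/-- A directed walk with respect to the arc relation `A`. -/
def IsDWalk {N : Type*} (A : N → N → Prop) (w : List N) : Prop := List.Chain' A w

/-- A directed `a`-`b`-path: a walk from `a` to `b` repeating no node. -/
def IsDPathFrom {N : Type*} (A : N → N → Prop) (a b : N) (w : List N) : Prop :=
  List.Chain' A w ∧ w.Nodup ∧ w.head? = some a ∧ w.getLast? = some b

/-- The arc relation `A` contains a proper cycle: a walk of length at least one
from a node to itself. -/
def HasProperCycle {N : Type*} (A : N → N → Prop) : Prop :=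
  ∃ w : List N, List.Chain' A w ∧ 2 ≤ w.length ∧ w.head? = w.getLast?

/-- Gärtner et al.'s `U_{uv}`: the nodes reachable from `u` by a path not
passing through `v` (except possibly as its last node). -/
def Uout {N : Type*} (A : N → N → Prop) (u v : N) : Set N :=
  {x | ∃ w, IsDPathFrom A u x w ∧ v ∉ w.dropLast}

/-- Gärtner et al.'s `U⁺_{vu}`: the nodes from which `v` is reachable by a path not
passing through `u` (except possibly as its first node). -/
def Uin {N : Type*} (A : N → N → Prop) (u v : N) : Set N :=
  {x | ∃ w, IsDPathFrom A x v w ∧ u ∉ w.tail}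

/-- Conditions (c), (d) and (e), common to both the Gärtner et al. and the less
redundant weak superbubble definitions. -/
def WSBCondsCDE {N : Type*} (A : N → N → Prop) (U : Set N) (u v : N) : Prop :=
  (∀ x ∈ U, ∀ y ∉ U, ∀ w, IsDPathFrom A y x w → u ∈ w) ∧
  (∀ x ∈ U, ∀ y ∉ U, ∀ w, IsDPathFrom A x y w → v ∈ w) ∧
  (∀ x y, A x y → x ∈ U → y ∈ U → ∀ w, IsDPathFrom A y x w → u ∈ w ∧ v ∈ w)

/-- Conditions (a)–(e) of Gärtner et al.'s weak superbubble definition. -/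
def WSBCondsOrig {N : Type*} (A : N → N → Prop) (U : Set N) (u v : N) : Prop :=
  (∀ x ∈ U, ∃ w, IsDPathFrom A u x w) ∧
  (∀ x ∈ U, ∃ w, IsDPathFrom A x v w) ∧
  WSBCondsCDE A U u v

/-- `(u, v)` is a weak superbubble with component `U` by Gärtner et al.'s definition. -/
def IsWSBOrig {N : Type*} (A : N → N → Prop) (u v : N) (U : Set N) : Prop :=
  u ∈ U ∧ v ∈ U ∧ U = Uout A u v ∧ U = Uin A u v ∧
  WSBCondsOrig A U u v ∧
  ¬ ∃ v' ∈ U, v' ≠ u ∧ v' ≠ v ∧ ∃ U' : Set N, u ∈ U' ∧ v' ∈ U' ∧ WSBCondsOrig A U' u v'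

/-- Conditions (a)–(e) of the less redundant weak superbubble definition. -/
def WSBCondsLR {N : Type*} (A : N → N → Prop) (U : Set N) (u v : N) : Prop :=
  (∀ x ∈ U, ∃ w, IsDPathFrom A u x w ∧ v ∉ w.dropLast) ∧
  (∀ x ∈ U, ∃ w, IsDPathFrom A x v w ∧ u ∉ w.tail) ∧
  WSBCondsCDE A U u v

/-- `(u, v)` is a weak superbubble with component `U` by the less redundant definition. -/
def IsWSBLR {N : Type*} (A : N → N → Prop) (u v : N) (U : Set N) : Prop :=
  u ∈ U ∧ v ∈ U ∧ WSBCondsLR A U u v ∧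
  ¬ ∃ v' ∈ U, v' ≠ u ∧ v' ≠ v ∧ ∃ U' : Set N, u ∈ U' ∧ v' ∈ U' ∧ WSBCondsLR A U' u v'

/-- Node set of the weak superbubble component of `(u, v)` (simplified definition):
`u`, `v` and all nodes on `u`-`v`-paths. -/
def sbNodes {N : Type*} (A : N → N → Prop) (u v : N) : Set N :=
  {u, v} ∪ {x | ∃ w, IsDPathFrom A u v w ∧ x ∈ w}

/-- Arc relation of the weak superbubble component of `(u, v)` (simplified definition):
all arcs on `u`-`v`-paths. -/
def sbArcs {N : Type*} (A : N → N → Prop) (u v : N) (a b : N) : Prop :=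
  ∃ w, IsDPathFrom A u v w ∧ (a, b) ∈ w.zip w.tail

/-- Separability of `(u, v)` in the simplified weak superbubble definition:
every arc of `A` not in the component `B` that is incident to a node of `V(B)`
is incoming to `u` or outgoing from `v`. -/
def SBSeparable {N : Type*} (A : N → N → Prop) (u v : N) : Prop :=
  ∀ a b, A a b → ¬ sbArcs A u v a b → (a ∈ sbNodes A u v ∨ b ∈ sbNodes A u v) →
    b = u ∨ a = v

/-- Acyclicity of `(u, v)` in the simplified weak superbubble definition:
the component contains no proper cycle. -/
def SBAcyclic {N : Type*} (A : N → N → Prop) (u v : N) : Prop :=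
  ¬ HasProperCycle (sbArcs A u v)

/-- `(u, v)` is a weak superbubble by the simplified definition. -/
def IsWSBSimp {N : Type*} (A : N → N → Prop) (u v : N) : Prop :=
  SBSeparable A u v ∧ SBAcyclic A u v ∧
  ¬ ∃ w ∈ sbNodes A u v, w ≠ u ∧ w ≠ v ∧
    (SBSeparable A u w ∧ SBAcyclic A u w) ∧ (SBSeparable A w v ∧ SBAcyclic A w v)

/-- The arc relation of the induced subgraph `G[U]` with the arc `(v, u)` removed. -/
def inducedMinus {N : Type*} (A : N → N → Prop) (U : Set N) (v u : N) (a b : N) : Prop :=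
  A a b ∧ a ∈ U ∧ b ∈ U ∧ (a, b) ≠ (v, u)

/-- The arc relation of the doubled graph of the bidirected graph with edge set `E`:
each bidirected edge `{xδ, yε}` yields the two arcs `(xδ, yε̂)` and `(yε, xδ̂)`. -/
def doubledArc {V : Type*} (E : BEdges V) (a b : SNode V) : Prop :=
  ∃ x y : SNode V, s(x, y) ∈ E ∧ ((a = x ∧ b = opp y) ∨ (a = y ∧ b = opp x))

end BidirectedDoubling

open BidirectedDoubling

/-- `b` is reachable from `a` avoiding `z`. -/
def Av {N : Type*} (A : N → N → Prop) (z a b : N) : Prop :=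
  a ≠ z ∧ Relation.ReflTransGen (fun p q => A p q ∧ q ≠ z) a b

theorem Av.trans' {N : Type*} {A : N → N → Prop} {z a b c : N}
    (h : Av A z a b) (h' : Av A z b c) : Av A z a c := ⟨h.1, h.2.trans h'.2⟩

theorem Av.right {N : Type*} {A : N → N → Prop} {z a b : N}
    (h : Av A z a b) : b ≠ z := by
  obtain ⟨h1, h2⟩ := h
  induction h2 with
  | refl => exact h1
  | tail _ h _ => exact h.2

theorem path_suffix {N : Type*} {A : N → N → Prop} {a b c : N} {s t : List N}
    (h : IsDPathFrom A a b (s ++ c :: t)) : IsDPathFrom A c b (c :: t) := by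
  obtain ⟨h1, h2, h3, h4⟩ := h
  refine ⟨h1.right_of_append, (List.nodup_append.1 h2).2.1, rfl, ?_⟩
  rw [← h4, List.getLast?_append]
  simp [List.getLast?_cons]

theorem path_prefix {N : Type*} {A : N → N → Prop} {a b c : N} {s t : List N}
    (h : IsDPathFrom A a b (s ++ c :: t)) : IsDPathFrom A a c (s ++ [c]) := by
  have e : s ++ c :: t = (s ++ [c]) ++ t := by simp
  obtain ⟨h1, h2, h3, h4⟩ := h
  rw [e] at h1 h2
  refine ⟨h1.left_of_append, (List.nodup_append.1 h2).1, ?_, by simp⟩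
  rw [← h3]; cases s <;> simp

theorem av_iff {N : Type*} {A : N → N → Prop} {z a b : N} :
    Av A z a b ↔ ∃ w, IsDPathFrom A a b w ∧ z ∉ w := by
  constructor
  · rintro ⟨h1, h2⟩
    induction h2 using Relation.ReflTransGen.head_induction_on with
    | refl => exact ⟨[b], ⟨by simp [List.Chain'], by simp, rfl, rfl⟩, by simpa using h1.symm⟩
    | @head a c hac _ ih =>
      obtain ⟨w, hw, hz⟩ := ih hac.2
      by_cases ha : a ∈ w
      · obtain ⟨s, t, rfl⟩ := List.append_of_mem ha
        exact ⟨a :: t, path_suffix hw, fun h => hz (by simp at h ⊢; tauto)⟩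
      · obtain ⟨h3, h4, h5, h6⟩ := hw
        cases w with
        | nil => simp at h5
        | cons d w =>
          simp at h5; subst h5
          refine ⟨a :: d :: w, ⟨List.isChain_cons_cons.2 ⟨hac.1, h3⟩, List.nodup_cons.2 ⟨ha, h4⟩, rfl, ?_⟩, ?_⟩
          · rw [← h6]; simp [List.getLast?_cons]
          · simp only [List.mem_cons, not_or] at hz ⊢
            exact ⟨h1.symm, hz⟩
  · rintro ⟨w, ⟨h1, _, h3, h4⟩, hz⟩
    induction w generalizing a with
    | nil => simp at h3
    | cons d w ih =>
      simp at h3; subst h3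
      have hd : d ≠ z := by rintro rfl; simp at hz
      refine ⟨hd, ?_⟩
      cases w with
      | nil => simp at h4; subst h4; exact .refl
      | cons c w =>
        have h1' := List.isChain_cons_cons.1 h1
        have := ih (a := c) (fun h => hz (List.mem_cons_of_mem _ h)) h1'.2 (by simp_all) rfl
          (by rw [← h4]; simp [List.getLast?_cons])
        exact .head ⟨h1'.1, this.1⟩ this.2

theorem path_end {N : Type*} {A : N → N → Prop} {u v : N} {w : List N}
    (h : IsDPathFrom A u v w) : v ∉ w.dropLast := by
  obtain ⟨_, h2, _, h4⟩ := h
  rw [List.getLast?_eq_some_iff] at h4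
  obtain ⟨s, rfl⟩ := h4
  simp only [List.dropLast_concat]
  intro h
  exact (List.nodup_append.1 h2).2.2 _ h v (by simp) rfl

theorem path_start {N : Type*} {A : N → N → Prop} {u v : N} {w : List N}
    (h : IsDPathFrom A u v w) : u ∉ w.tail := by
  obtain ⟨_, h2, h3, _⟩ := h
  cases w with
  | nil => simp
  | cons a w => simp at h3; subst h3; exact (List.nodup_cons.1 h2).1

theorem mem_Uout {N : Type*} {A : N → N → Prop} {u v x : N} (hx : x ≠ v) :
    x ∈ Uout A u v ↔ Av A v u x := by
  rw [av_iff]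
  refine exists_congr fun w => and_congr_right fun h => ?_
  obtain ⟨_, _, _, h4⟩ := h
  rw [List.getLast?_eq_some_iff] at h4
  obtain ⟨s, rfl⟩ := h4
  simp [hx.symm]

theorem mem_Uin {N : Type*} {A : N → N → Prop} {u v x : N} (hx : x ≠ u) :
    x ∈ Uin A u v ↔ Av A u x v := by
  rw [av_iff]
  refine exists_congr fun w => and_congr_right fun h => ?_
  obtain ⟨_, _, h3, _⟩ := h
  cases w with
  | nil => simp
  | cons a w => simp at h3; subst h3; simp [hx.symm]

theorem av_of_through {N : Type*} {A : N → N → Prop} {u v y : N} {w : List N} (huv : u ≠ v)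
    (h : IsDPathFrom A u y w) (hv : v ∈ w) : Av A u v y := by
  obtain ⟨s, t, rfl⟩ := List.append_of_mem hv
  refine av_iff.2 ⟨_, path_suffix h, ?_⟩
  have := path_start h
  cases s with
  | nil => have := h.2.2.1; simp at this; exact absurd this.symm huv
  | cons a s => simp at this ⊢; tauto

theorem av_of_through' {N : Type*} {A : N → N → Prop} {u v y : N} {w : List N} (huv : u ≠ v)
    (h : IsDPathFrom A y v w) (hu : u ∈ w) : Av A v y u := by
  obtain ⟨s, t, rfl⟩ := List.append_of_mem hu
  refine av_iff.2 ⟨_, path_prefix h, ?_⟩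
  have := path_end h
  cases t with
  | nil => have := h.2.2.2; simp at this; exact absurd this huv
  | cons a t =>
    rw [List.dropLast_append_of_ne_nil (by simp), List.dropLast_cons_cons] at this
    simp at this ⊢; tauto

theorem cde_av {N : Type*} {A : N → N → Prop} {U : Set N} {u v : N} :
    WSBCondsCDE A U u v ↔ (∀ x ∈ U, ∀ y ∉ U, ¬ Av A u y x) ∧ (∀ x ∈ U, ∀ y ∉ U, ¬ Av A v x y) ∧
      (∀ x y, A x y → x ∈ U → y ∈ U → ¬ Av A u y x ∧ ¬ Av A v y x) := by
  simp only [WSBCondsCDE, av_iff, not_exists, not_and, not_not, forall_and]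

theorem lr_of_orig {N : Type*} {A : N → N → Prop} {U : Set N} {u v : N} (huv : u ≠ v)
    (hu : u ∈ U) (hv : v ∈ U) (h : WSBCondsOrig A U u v) :
    ∃ U' : Set N, u ∈ U' ∧ v ∈ U' ∧ WSBCondsLR A U' u v := by
  obtain ⟨ha, hb, h⟩ := h
  rw [cde_av] at h
  obtain ⟨hc, hd, he⟩ := h
  have uO : u ∈ Uout A u v := (mem_Uout huv).2 ⟨huv, .refl⟩
  have vI : v ∈ Uin A u v := (mem_Uin huv.symm).2 ⟨huv.symm, .refl⟩
  have uI : u ∈ Uin A u v := by obtain ⟨w, hw⟩ := ha v hv; exact ⟨w, hw, path_start hw⟩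
  have vO : v ∈ Uout A u v := by obtain ⟨w, hw⟩ := ha v hv; exact ⟨w, hw, path_end hw⟩
  refine ⟨{x | x ∈ U ∧ x ∈ Uout A u v ∧ x ∈ Uin A u v}, ⟨hu, uO, uI⟩, ⟨hv, vO, vI⟩,
    fun x hx => hx.2.1, fun x hx => hx.2.2, cde_av.2 ⟨?_, ?_, ?_⟩⟩
  · rintro x ⟨hxU, hxO, hxI⟩ y hy hyx
    have hyU : y ∈ U := by by_contra h; exact hc x hxU y h hyx
    have hyv : Av A u y v := hyx.trans' ((mem_Uin hyx.right).1 hxI)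
    have hyI : y ∈ Uin A u v := (mem_Uin hyx.1).2 hyv
    have hyO : y ∉ Uout A u v := fun h => hy ⟨hyU, h, hyI⟩
    have hne : y ≠ v := by rintro rfl; exact hyO vO
    have hvy : Av A u v y := by
      obtain ⟨w, hw⟩ := ha y hyU
      refine av_of_through huv hw ?_
      by_contra hvw
      exact hyO ((mem_Uout hne).2 (av_iff.2 ⟨w, hw, hvw⟩))
    rcases hvy.2.cases_head with h | ⟨p, hvp, hpy⟩
    · exact hne h.symm
    have hp : Av A u p y := ⟨hvp.2, hpy⟩
    have hpU : p ∈ U := by by_contra h; exact hc y hyU p h hp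
    exact (he v p hvp.1 hv hpU).1 (hp.trans' hyv)
  · rintro x ⟨hxU, hxO, hxI⟩ y hy hxy
    have hyU : y ∈ U := by by_contra h; exact hd x hxU y h hxy
    have huy : Av A v u y := ((mem_Uout hxy.1).1 hxO).trans' hxy
    have hyO : y ∈ Uout A u v := (mem_Uout hxy.right).2 huy
    have hyI : y ∉ Uin A u v := fun h => hy ⟨hyU, hyO, h⟩
    have hne : y ≠ u := by rintro rfl; exact hyI uI
    have hyu : Av A v y u := by
      obtain ⟨w, hw⟩ := hb y hyU
      refine av_of_through' huv hw ?_
      by_contra hvw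
      exact hyI ((mem_Uin hne).2 (av_iff.2 ⟨w, hw, hvw⟩))
    rcases hyu.2.cases_tail with h | ⟨p, hyp, hpu⟩
    · exact hne h.symm
    have hp : Av A v y p := ⟨hyu.1, hyp⟩
    have hpU : p ∈ U := by by_contra h; exact hd y hyU p h hp
    exact (he p u hpu.1 hpU hu).2 (huy.trans' hp)
  · rintro x y hxy hx hy
    exact he x y hxy hx.1 hy.1

theorem lr_eq {N : Type*} {A : N → N → Prop} {U : Set N} {u v : N}
    (hu : u ∈ U) (hv : v ∈ U) (h : WSBCondsLR A U u v) :
    U = Uout A u v ∧ U = Uin A u v := by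
  obtain ⟨ha, hb, h⟩ := h
  rw [cde_av] at h
  obtain ⟨hc, hd, he⟩ := h
  constructor
  · refine Set.Subset.antisymm (fun x hx => ha x hx) fun x hx => ?_
    by_contra hxU
    have : x ≠ v := by rintro rfl; exact hxU hv
    exact hd u hu x hxU ((mem_Uout this).1 hx)
  · refine Set.Subset.antisymm (fun x hx => hb x hx) fun x hx => ?_
    by_contra hxU
    have : x ≠ u := by rintro rfl; exact hxU hu
    exact hc v hv x hxU ((mem_Uin this).1 hx)

/-- For distinct nodes `u ≠ v` of a directed graph, `(u, v)` is a weak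
superbubble by Gärtner et al.'s definition iff it is a weak superbubble by the less
redundant definition; moreover, the respective components coincide. -/
theorem wsb_orig_iff_lr {N : Type*} (A : N → N → Prop) (u v : N) (huv : u ≠ v) :
    ((∃ U : Set N, IsWSBOrig A u v U) ↔ (∃ U : Set N, IsWSBLR A u v U)) ∧
    (∀ U U' : Set N, IsWSBOrig A u v U → IsWSBLR A u v U' → U = U') := by
  have key : ∀ U, IsWSBOrig A u v U → IsWSBLR A u v U := by
    rintro U ⟨hu, hv, hO, hI, ⟨_, _, hc⟩, hm⟩
    refine ⟨hu, hv, ⟨fun x hx => ?_, fun x hx => ?_, hc⟩, ?_⟩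
    · rw [hO] at hx; exact hx
    · rw [hI] at hx; exact hx
    · rintro ⟨v', hv', h1, h2, U', hu', hvU', ha, hb, hc'⟩
      exact hm ⟨v', hv', h1, h2, U', hu', hvU',
        fun x hx => (ha x hx).imp fun _ h => h.1, fun x hx => (hb x hx).imp fun _ h => h.1, hc'⟩
  refine ⟨⟨fun ⟨U, h⟩ => ⟨U, key U h⟩, ?_⟩, ?_⟩
  · rintro ⟨U, hu, hv, h, hm⟩
    obtain ⟨hO, hI⟩ := lr_eq hu hv h
    refine ⟨U, hu, hv, hO, hI, ⟨fun x hx => (h.1 x hx).imp fun _ h => h.1,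
      fun x hx => (h.2.1 x hx).imp fun _ h => h.1, h.2.2⟩, ?_⟩
    rintro ⟨v', hv', h1, h2, U', hu', hvU', hc'⟩
    exact hm ⟨v', hv', h1, h2, lr_of_orig h1.symm hu' hvU' hc'⟩
  · intro U U' h h'
    rw [h.2.2.1, (lr_eq h'.1 h'.2.1 h'.2.2.1).1]
end

section
/- Let G be a directed graph and let (u, v) be a weak superbubble by the less redundant definition with component U. Then the graph G[U]∖(v,u) contains no proper cycle. -/
open BidirectedDoubling

theorem aux_path {N : Type*} {R : N → N → Prop} {a b : N}
    (h : Relation.ReflTransGen R a b) : ∃ w, IsDPathFrom R a b w := by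
  induction h using Relation.ReflTransGen.head_induction_on with
  | refl => exact ⟨[b], by simp [IsDPathFrom, List.Chain']⟩
  | head hac _ ih =>
    rename_i a c _
    obtain ⟨w, hw, hn, hh, hl⟩ := ih
    by_cases ha : a ∈ w
    · obtain ⟨s, t, rfl⟩ := List.append_of_mem ha
      refine ⟨a :: t, ?_, ?_, rfl, ?_⟩
      · exact List.IsChain.right_of_append hw
      · exact (List.nodup_append.1 hn).2.1
      · simpa using hl
    · cases w with
      | nil => simp at hh
      | cons d w =>
        simp only [List.head?_cons, Option.some.injEq] at hh
        subst hh
        refine ⟨a :: d :: w, ?_, ?_, rfl, ?_⟩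
        · exact List.isChain_cons_cons.2 ⟨hac, hw⟩
        · exact List.nodup_cons.2 ⟨ha, hn⟩
        · simpa using hl

theorem aux_mem {N : Type*} {R : N → N → Prop} {u : N} (hR : ∀ x, ¬ R x u) :
    ∀ (w : List N) (y : N), List.IsChain R (y :: w) → y ≠ u → u ∉ y :: w
  | [], y, _, hy => by simpa using hy.symm
  | z :: w, y, hc, hy => by
    obtain ⟨h1, h2⟩ := List.isChain_cons_cons.1 hc
    have := aux_mem hR w z h2 (by rintro rfl; exact hR _ h1)
    rw [List.mem_cons]
    rintro (h | h)
    · exact hy h.symm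
    · exact this h

theorem aux_reach {N : Type*} {R : N → N → Prop} :
    ∀ (w : List N) (y x : N), List.IsChain R (y :: w) → (y :: w).getLast? = some x →
      Relation.ReflTransGen R y x
  | [], y, x, _, h => by
    simp at h
    subst h
    exact .refl
  | z :: w, y, x, hc, h => by
    obtain ⟨h1, h2⟩ := List.isChain_cons_cons.1 hc
    exact .head h1 (aux_reach w z x h2 (by simpa using h))

/-- If `(u, v)` is a weak superbubble by the less redundant definition
with component `U`, then `G[U] ∖ (v, u)` contains no proper cycle. -/
theorem wsb_acyclicity {N : Type*} (A : N → N → Prop) (u v : N) (U : Set N)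
    (huv : u ≠ v) (h : IsWSBLR A u v U) :
    ¬ HasProperCycle (inducedMinus A U v u) := by
  obtain ⟨_, _, ⟨ha, _, _, _, he⟩, _⟩ := h
  have hR : ∀ x, ¬ inducedMinus A U v u x u := by
    rintro x ⟨hA, hx, hu, hne⟩
    obtain ⟨w, hw, hv⟩ := ha x hx
    have hvw := (he x u hA hx hu w hw).2
    obtain ⟨_, _, _, hl⟩ := hw
    rw [← List.dropLast_append_getLast? x hl, List.mem_append] at hvw
    rcases hvw with h | h
    · exact hv h
    · simp at h
      exact hne (by rw [h])
  rintro ⟨w, hc, hlen, hhl⟩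
  match w, hc, hlen, hhl with
  | x :: y :: w, hc, _, hhl =>
    obtain ⟨h1, h2⟩ := List.isChain_cons_cons.1 hc
    have hreach := aux_reach w y x h2 (by simpa using hhl.symm)
    obtain ⟨p, hp, hn, hh, hl⟩ := aux_path hreach
    have hpA : IsDPathFrom A y x p := ⟨List.IsChain.imp (fun _ _ h => h.1) hp, hn, hh, hl⟩
    have hup := (he x y h1.1 h1.2.1 h1.2.2.1 p hpA).1
    cases p with
    | nil => simp at hh
    | cons d p =>
      simp only [List.head?_cons, Option.some.injEq] at hh
      subst hh
      exact aux_mem hR p d hp (by rintro rfl; exact hR _ h1) hup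
end

section
/- Let G be a directed graph and let (u, v) be a weak superbubble by the less redundant definition with component U. Let B be the weak superbubble component of (u, v) by the simplified definition, i.e., the subgraph of G consisting of u, v and all nodes and arcs lying on some u-v path. Then G[U]∖(v,u) = B. -/
open BidirectedDoubling

theorem dpath_iff {N : Type*} {A : N → N → Prop} {a b : N} {w : List N} :
    IsDPathFrom A a b w ↔
      List.IsChain A w ∧ w.Nodup ∧ w.head? = some a ∧ w.getLast? = some b := Iff.rfl

theorem dpath_split {N : Type*} {A : N → N → Prop} {a b x : N} {l₁ l₂ : List N}
    (h : IsDPathFrom A a b (l₁ ++ x :: l₂)) :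
    IsDPathFrom A a x (l₁ ++ [x]) ∧ IsDPathFrom A x b (x :: l₂) := by
  rw [dpath_iff] at h
  obtain ⟨h1, h2, h3, h4⟩ := h
  rw [List.isChain_split] at h1
  rw [dpath_iff, dpath_iff]
  refine ⟨⟨h1.1, ?_, ?_, ?_⟩, h1.2, ?_, ?_, ?_⟩
  · rw [List.nodup_append] at h2 ⊢
    grind
  · cases l₁ <;> simpa using h3
  · simp
  · exact (List.nodup_append.1 h2).2.1
  · simp
  · simpa [List.getLast?_append] using h4

theorem exists_dpath {N : Type*} {A : N → N → Prop} (w : List N) : ∀ a b : N,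
    List.IsChain A w → w.head? = some a → w.getLast? = some b →
    ∃ p, IsDPathFrom A a b p ∧ ∀ x ∈ p, x ∈ w := by
  induction w with
  | nil => intro a b _ h; simp at h
  | cons c w ih =>
    intro a b h1 h2 h3
    simp only [List.head?_cons, Option.some.injEq] at h2
    subst h2
    cases w with
    | nil =>
      simp only [List.getLast?_singleton, Option.some.injEq] at h3
      subst h3
      exact ⟨[c], by simp [dpath_iff], by simp⟩
    | cons d w =>
      rw [List.isChain_cons_cons] at h1
      obtain ⟨p, hp, hs⟩ := ih d b h1.2 (by simp) (by simpa using h3)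
      by_cases hc : c ∈ p
      · obtain ⟨l₁, l₂, rfl⟩ := List.append_of_mem hc
        exact ⟨c :: l₂, (dpath_split hp).2, fun x hx => List.mem_cons_of_mem _
          (hs x (List.mem_append_right _ hx))⟩
      · rw [dpath_iff] at hp
        refine ⟨c :: p, dpath_iff.2 ⟨?_, ?_, by simp, ?_⟩, ?_⟩
        · rw [List.isChain_cons]
          refine ⟨?_, hp.1⟩
          intro y hy
          rw [hp.2.2.1] at hy
          simp only [Option.mem_def, Option.some.injEq] at hy
          exact hy ▸ h1.1
        · exact List.nodup_cons.2 ⟨hc, hp.2.1⟩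
        · rw [List.getLast?_cons, hp.2.2.2]; rfl
        · intro x hx
          rcases List.mem_cons.1 hx with rfl | hx
          · simp
          · exact List.mem_cons_of_mem _ (hs x hx)

theorem zip_tail_split {N : Type*} {a b : N} (w : List N) (h : (a, b) ∈ w.zip w.tail) :
    ∃ l₁ l₂, w = l₁ ++ a :: b :: l₂ := by
  induction w with
  | nil => simp at h
  | cons c w ih =>
    cases w with
    | nil => simp at h
    | cons d w =>
      simp only [List.tail_cons, List.zip_cons_cons, List.mem_cons, Prod.mk.injEq] at h
      rcases h with ⟨rfl, rfl⟩ | h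
      · exact ⟨[], w, rfl⟩
      · obtain ⟨l₁, l₂, e⟩ := ih (by simpa using h)
        exact ⟨c :: l₁, l₂, by rw [e]; rfl⟩

theorem mem_zip_tail {N : Type*} {a b : N} (l₁ l₂ : List N) :
    (a, b) ∈ (l₁ ++ a :: b :: l₂).zip (l₁ ++ a :: b :: l₂).tail := by
  induction l₁ with
  | nil => simp
  | cons c l ih =>
    cases l with
    | nil => simp
    | cons d l =>
      simp only [List.cons_append, List.tail_cons, List.zip_cons_cons, List.mem_cons] at ih ⊢
      exact Or.inr ih

theorem dpath_last {N : Type*} {A : N → N → Prop} {a b : N} {w : List N}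
    (h : IsDPathFrom A a b w) : ∃ l, w = l ++ [b] := by
  exact List.getLast?_eq_some_iff.1 (dpath_iff.1 h).2.2.2

theorem dpath_first {N : Type*} {A : N → N → Prop} {a b : N} {w : List N}
    (h : IsDPathFrom A a b w) : ∃ l, w = a :: l := by
  exact List.head?_eq_some_iff.1 (dpath_iff.1 h).2.2.1

/-- If `(u, v)` is a weak superbubble by the less redundant definition
with component `U`, and `B` is the weak superbubble component by the simplified
definition, then `G[U] ∖ (v, u) = B` (as node set and arc relation). -/
theorem wsb_component_eq {N : Type*} (A : N → N → Prop) (u v : N) (U : Set N)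
    (huv : u ≠ v) (h : IsWSBLR A u v U) :
    U = sbNodes A u v ∧
    (∀ a b, inducedMinus A U v u a b ↔ sbArcs A u v a b) := by
  obtain ⟨hu, hv, ⟨ha, hb, hc, hd, he⟩, -⟩ := h
  -- paths avoiding the other endpoint
  have ha' : ∀ x ∈ U, x ≠ v → ∃ w, IsDPathFrom A u x w ∧ v ∉ w := by
    intro x hx hxv
    obtain ⟨w, hw, hvw⟩ := ha x hx
    obtain ⟨l, rfl⟩ := dpath_last hw
    refine ⟨_, hw, ?_⟩
    simp only [List.dropLast_concat] at hvw
    simp [hvw, hxv.symm]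
  have hb' : ∀ x ∈ U, x ≠ u → ∃ w, IsDPathFrom A x v w ∧ u ∉ w := by
    intro x hx hxv
    obtain ⟨w, hw, hvw⟩ := hb x hx
    obtain ⟨l, rfl⟩ := dpath_first hw
    refine ⟨_, hw, ?_⟩
    simp only [List.tail_cons] at hvw
    simp [hvw, hxv.symm]
  have key : ∀ a b, A a b → a ∈ U → b ∈ U → (a, b) ≠ (v, u) → sbArcs A u v a b := by
    intro a b hab haU hbU hne
    by_cases hav : a = v
    · subst hav
      have hbu : b ≠ u := fun e => hne (by rw [e])
      obtain ⟨w, hw, hn⟩ := hb' b hbU hbu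
      exact absurd (he _ _ hab haU hbU w hw).1 hn
    by_cases hbu : b = u
    · subst hbu
      obtain ⟨w, hw, hn⟩ := ha' a haU hav
      exact absurd (he _ _ hab haU hbU w hw).2 hn
    obtain ⟨p, hp, hvp⟩ := ha' a haU hav
    obtain ⟨q, hq, huq⟩ := hb' b hbU hbu
    have hdis : ∀ x ∈ p, x ∉ q := by
      intro x hxp hxq
      obtain ⟨p₁, p₂, rfl⟩ := List.append_of_mem hxp
      obtain ⟨q₁, q₂, rfl⟩ := List.append_of_mem hxq
      have hp2 := dpath_iff.1 (dpath_split hp).2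
      have hq1 := dpath_iff.1 (dpath_split hq).1
      have hup : u ∉ x :: p₂ := by
        intro hm
        have hxu : u ≠ x := by
          rintro rfl
          exact huq (by simp)
        have hm2 : u ∈ p₂ := by simpa [hxu] using hm
        have hnd := (dpath_iff.1 hp).2.1
        have hhd := (dpath_iff.1 hp).2.2.1
        rw [List.nodup_append] at hnd
        cases p₁ with
        | nil => 
          simp at hhd
          exact hxu hhd.symm
        | cons c p₁ =>
          simp at hhd
          exact hnd.2.2 u (by simp [hhd]) u (by simp [hm2]) rfl
      have hch : List.IsChain A (q₁ ++ x :: p₂) := List.isChain_split.2 ⟨hq1.1, hp2.1⟩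
      obtain ⟨r, hr, hrs⟩ := exists_dpath (q₁ ++ x :: p₂) b a hch
        (by have := hq1.2.2.1; cases q₁ <;> simpa using this)
        (by have := hp2.2.2.2; simpa [List.getLast?_append] using this)
      have hur := hrs u (he _ _ hab haU hbU r hr).1
      rcases List.mem_append.1 hur with h1 | h1
      · exact huq (List.mem_append_left _ h1)
      · exact hup h1
    obtain ⟨p', rfl⟩ := dpath_last hp
    obtain ⟨q', rfl⟩ := dpath_first hq
    rw [dpath_iff] at hp hq
    refine ⟨p' ++ a :: b :: q', dpath_iff.2 ⟨?_, ?_, ?_, ?_⟩, mem_zip_tail _ _⟩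
    · exact List.isChain_split.2 ⟨hp.1, List.isChain_cons_cons.2 ⟨hab, hq.1⟩⟩
    · have : p' ++ a :: b :: q' = (p' ++ [a]) ++ (b :: q') := by simp
      rw [this, List.nodup_append]
      exact ⟨hp.2.1, hq.2.1, fun x hx y hy e => hdis x hx (e ▸ hy)⟩
    · have := hp.2.2.1
      cases p' <;> simpa using this
    · have := hq.2.2.2
      simpa [List.getLast?_append] using this
  have memU : ∀ w, IsDPathFrom A u v w → ∀ x ∈ w, x ∈ U := by
    intro w hw x hx
    by_contra hxU
    have hxv : x ≠ v := fun e => hxU (e ▸ hv)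
    obtain ⟨l₁, l₂, rfl⟩ := List.append_of_mem hx
    have h1 := hd u hu x hxU _ (dpath_split hw).1
    obtain ⟨l, hl⟩ := dpath_last (dpath_split hw).2
    have hvm : v ∈ x :: l₂ := by rw [hl]; simp
    have hnd := (List.nodup_append.1 (dpath_iff.1 hw).2.1).2.2
    have h2 : v ∈ l₁ := by simpa [hxv.symm] using h1
    exact hnd v h2 v hvm rfl
  constructor
  · ext x
    constructor
    · intro hx
      by_cases hxu : x = u
      · exact Or.inl (Or.inl hxu)
      by_cases hxv : x = v
      · exact Or.inl (Or.inr hxv)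
      right
      obtain ⟨p, hp, hvp⟩ := ha' x hx hxv
      obtain ⟨l, rfl⟩ := dpath_last hp
      rcases List.eq_nil_or_concat l with rfl | ⟨l', y, rfl⟩
      · have := (dpath_iff.1 hp).2.2.1
        simp at this
        exact absurd this hxu
      have e : l' ++ [y] ++ [x] = l' ++ y :: [x] := by simp
      simp only [List.concat_eq_append, e] at hp hvp
      have hs := dpath_split hp
      have hyU : y ∈ U := by
        by_contra hy
        have := hd u hu y hy _ hs.1
        exact hvp (by simp at this ⊢; tauto)
      have hyx : A y x := by simpa using (dpath_iff.1 hs.2).1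
      obtain ⟨w, hw, hm⟩ := key y x hyx hyU hx (by simp [hxu])
      exact ⟨w, hw, List.mem_of_mem_tail (List.of_mem_zip hm).2⟩
    · rintro ((rfl | rfl) | ⟨w, hw, hx⟩)
      · exact hu
      · exact hv
      · exact memU w hw x hx
  · intro a b
    constructor
    · rintro ⟨h1, h2, h3, h4⟩
      exact key a b h1 h2 h3 h4
    · rintro ⟨w, hw, hm⟩
      have hm' := List.of_mem_zip hm
      refine ⟨?_, memU w hw _ hm'.1, memU w hw _ (List.mem_of_mem_tail hm'.2), ?_⟩
      · obtain ⟨l₁, l₂, rfl⟩ := zip_tail_split w hm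
        exact (List.isChain_cons_cons.1 (dpath_iff.1 (dpath_split hw).2).1).1
      · intro e
        obtain ⟨l, rfl⟩ := dpath_first hw
        have hnd := (List.nodup_cons.1 (dpath_iff.1 hw).2.1).1
        simp only [Prod.mk.injEq] at e
        rw [e.2] at hm'
        exact hnd hm'.2
end
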